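/- For the dehomogenisation at α=2: the automorphism σ_2 of the quantum matrix algebra K[z_{ij}] satisfies σ_2(z_{ij}) = q·z_{ij} for all 1≤i≤m and 1≤j<n−m, while σ_2(z_{i,n−m}) = q^{−1}·z_{i,n−m}. Consequently y_2 z_{ij} = q z_{ij} y_2 for 1≤j<n−m and y_2 z_{i,n−m} = q^{−1} z_{i,n−m} y_2. -/

import Mathlib

open scoped BigOperators

namespace QG

variable (K : Type*) [Field K]

/-- The defining relations of the quantum matrix algebra `O_q(M_{m,n})`. -/
inductive QMatRel (q : K) (m n : ℕ) :
    FreeAlgebra K (Fin m × Fin n) → FreeAlgebra K (Fin m × Fin n) → Prop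
  | row : ∀ (i : Fin m) (j l : Fin n), j < l →
      QMatRel q m n (FreeAlgebra.ι K (i, j) * FreeAlgebra.ι K (i, l))
        (q • (FreeAlgebra.ι K (i, l) * FreeAlgebra.ι K (i, j)))
  | col : ∀ (i k : Fin m) (j : Fin n), i < k →
      QMatRel q m n (FreeAlgebra.ι K (i, j) * FreeAlgebra.ι K (k, j))
        (q • (FreeAlgebra.ι K (k, j) * FreeAlgebra.ι K (i, j)))
  | comm : ∀ (i k : Fin m) (j l : Fin n), k < i → j < l →
      QMatRel q m n (FreeAlgebra.ι K (i, j) * FreeAlgebra.ι K (k, l))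
        (FreeAlgebra.ι K (k, l) * FreeAlgebra.ι K (i, j))
  | qrel : ∀ (i k : Fin m) (j l : Fin n), i < k → j < l →
      QMatRel q m n
        (FreeAlgebra.ι K (i, j) * FreeAlgebra.ι K (k, l) -
          FreeAlgebra.ι K (k, l) * FreeAlgebra.ι K (i, j))
        ((q - q⁻¹) • (FreeAlgebra.ι K (i, l) * FreeAlgebra.ι K (k, j)))

/-- The quantum matrix algebra `O_q(M_{m,n})`. -/
abbrev QMat (q : K) (m n : ℕ) := RingQuot (QMatRel K q m n)

/-- The generator `X_{ij}` of `O_q(M_{m,n})`. -/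
noncomputable def X (q : K) {m n : ℕ} (i : Fin m) (j : Fin n) : QMat K q m n :=
  RingQuot.mkAlgHom K (QMatRel K q m n) (FreeAlgebra.ι K (i, j))

/-- The number of inversions (Coxeter length) of a permutation of `Fin t`. -/
def invCount {t : ℕ} (σ : Equiv.Perm (Fin t)) : ℕ :=
  ((Finset.univ : Finset (Fin t × Fin t)).filter fun p => p.1 < p.2 ∧ σ p.2 < σ p.1).card

/-- The quantum minor `Σ_σ (-q)^{ℓ(σ)} x_{σ(1)1} ⋯ x_{σ(t)t}` of a `t × t`
matrix of elements of a `K`-algebra. -/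
noncomputable def qMinor {A : Type*} [Ring A] [Algebra K A] (q : K) (t : ℕ)
    (x : Fin t → Fin t → A) : A :=
  ∑ σ : Equiv.Perm (Fin t), ((-q) ^ invCount σ) • (List.ofFn fun k => x (σ k) k).prod

/-- The maximal (`m × m`) quantum minor `[J]` of `O_q(M_{m,n})`, with column index set `J`
(columns taken in increasing order, rows `1,…,m`).  (Defined to be `0` if `J` does not
have exactly `m` elements.) -/
noncomputable def grMinor (q : K) (m : ℕ) {n : ℕ} (J : Finset (Fin n)) : QMat K q m n :=
  if h : J.card = m then
    qMinor K q m (fun i k => X K q i (J.orderEmbOfFin h k)) else 0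

/-- The set of maximal quantum minors of `O_q(M_{m,n})`. -/
def grGenSet (q : K) (m n : ℕ) : Set (QMat K q m n) :=
  {a | ∃ J : Finset (Fin n), a = grMinor K q m J}

/-- The quantum grassmannian `O_q(G(m,n))`: the subalgebra of `O_q(M_{m,n})`
generated by the maximal quantum minors. -/
noncomputable def qGrass (q : K) (m n : ℕ) : Subalgebra K (QMat K q m n) :=
  Algebra.adjoin K (grGenSet K q m n)

/-- The maximal quantum minor `[J]` viewed as an element of the quantum grassmannian. -/
noncomputable def grE (q : K) (m : ℕ) {n : ℕ} (J : Finset (Fin n)) : ↥(qGrass K q m n) :=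
  ⟨grMinor K q m J, Algebra.subset_adjoin ⟨J, rfl⟩⟩

/-- Reduction of a natural number modulo `n`, landing in `Fin n` (this encodes the
paper's convention that a column index is read modulo `n`; indices here are 0-based). -/
def fmod (n : ℕ) (hn : 0 < n) (k : ℕ) : Fin n := ⟨k % n, Nat.mod_lt k hn⟩

/-- The index set `{α, α+1, …, α+m-1}` (read modulo `n`) of a consecutive quantum minor
(0-based indices). -/
def consecSet {n : ℕ} (hn : 0 < n) (m : ℕ) (α : ℕ) : Finset (Fin n) :=
  (Finset.range m).image fun k => fmod n hn (α + k)

end QG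
namespace QG

variable (K : Type*) [Field K]

/-- Localisation of a `K`-algebra `A` at the powers of a normal element `u`:
an algebra `B` together with an injective map `A → B` inverting `u`, such that every
element of `B` has the form `a·u^{-k}`. -/
structure NormalLoc (A : Type*) [Ring A] [Algebra K A]
    (B : Type*) [Ring B] [Algebra K B] (u : A) where
  emb : A →ₐ[K] B
  inj : Function.Injective emb
  isUnit : IsUnit (emb u)
  surj : ∀ b : B, ∃ (a : A) (k : ℕ), b = emb a * ↑(isUnit.unit⁻¹ ^ k)

/-- The index set (0-based) of the quantum minor defining the dehomogenisation
generator `x_{ij}` at the consecutive minor starting at `α`: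
`M_α ∪ {~(α+m+j)} ∖ {~(α+(m-1-i))}`. -/
def JxSet {n : ℕ} (hn : 0 < n) (m : ℕ) (α : ℕ) (i : Fin m) (j : Fin (n - m)) :
    Finset (Fin n) :=
  insert (fmod n hn (α + m + j)) ((consecSet hn m α).erase (fmod n hn (α + (m - 1 - i))))

/-- The generator `x_{ij} = [M_α ∪ {~(α+m+j)} ∖ {~(α+(m-1-i))}]·M_α^{-1}` of the
dehomogenisation of the quantum grassmannian at the consecutive minor `M_α`. -/
noncomputable def xElt (q : K) (m n : ℕ) (hn : 0 < n) (α : ℕ)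
    {B : Type*} [Ring B] [Algebra K B]
    (L : NormalLoc K (↥(qGrass K q m n)) B (grE K q m (consecSet hn m α)))
    (i : Fin m) (j : Fin (n - m)) : B :=
  L.emb (grE K q m (JxSet hn m α i j)) * ↑(L.isUnit.unit⁻¹)

/-- `B` is a skew-Laurent extension `R[y^{±1};σ]` of the subalgebra `R`, where `σ` is
conjugation by the unit `y`:  `R` is stable under conjugation by `y` and `B` is free as a
left `R`-module with basis the (integer) powers of `y`. -/
def IsSkewLaurent {B : Type*} [Ring B] [Algebra K B] (R : Subalgebra K B) (y : Bˣ) : Prop :=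
  (∀ r ∈ R, (y : B) * r * ((y⁻¹ : Bˣ) : B) ∈ R) ∧
    ∀ b : B, ∃! f : ℤ →₀ ↥R, b = f.sum fun k r => (r : B) * ((y ^ k : Bˣ) : B)

/-- The quantum minor of a matrix of elements with row index set `R` and column index
set `C` (rows and columns taken in increasing order); `0` if the cardinalities differ. -/
noncomputable def finsetMinor {B : Type*} [Ring B] [Algebra K B] (q : K) {m c : ℕ}
    (x : Fin m → Fin c → B) (R : Finset (Fin m)) (C : Finset (Fin c)) : B :=
  if h : C.card = R.card then
    qMinor K q R.card (fun a b => x (R.orderEmbOfFin rfl a) (C.orderEmbOfFin h b))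
  else 0

/-- The row set `(α+m) − (M_α ∖ I_r)` (0-based) of the image of the maximal minor `[I]`
under the dehomogenisation at `M_α`. -/
def rowSetOf {n : ℕ} (hn : 0 < n) (m : ℕ) (α : ℕ) (I : Finset (Fin n)) : Finset (Fin m) :=
  (Finset.univ.filter fun k : Fin m => fmod n hn (α + k) ∉ I).image Fin.rev

/-- The column set `I_c − (α+m−1)` (0-based) of the image of the maximal minor `[I]`
under the dehomogenisation at `M_α`. -/
def colSetOf {n : ℕ} (hn : 0 < n) (m : ℕ) (α : ℕ) (I : Finset (Fin n)) :
    Finset (Fin (n - m)) :=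
  Finset.univ.filter fun d : Fin (n - m) => fmod n hn (α + m + d) ∈ I

/-- The last index (0-based, corresponding to the paper's index `n`). -/
def lastIdx (n : ℕ) (hn : 0 < n) : Fin n := ⟨n - 1, by omega⟩

/-- The 2-cocycle `c((s_1,…,s_n),(t_1,…,t_n)) = ∏_{j ≠ n} p^{s_n t_j}` on `ℤ^n`. -/
noncomputable def cmap {n : ℕ} (hn : 0 < n) (p : K) :
    (Fin n → ℤ) → (Fin n → ℤ) → K := fun s t =>
  ∏ j ∈ Finset.univ.filter (fun j : Fin n => j ≠ lastIdx n hn),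
    p ^ (s (lastIdx n hn) * t j)

/-- The content `ε(j+m) − ε(m+1−i)` of the dehomogenisation generator `x_{ij}`
(0-based: `ε(m+j) − ε(m-1-i)`). -/
def xContent (m n : ℕ) (i : Fin m) (j : Fin (n - m)) : Fin n → ℤ := fun l =>
  (if (l : ℕ) = m + j then 1 else 0) - (if (l : ℕ) = m - 1 - i then 1 else 0)

/-- The content `ε(1) + ⋯ + ε(m)` of `y` (equivalently, of a consecutive minor `M_1`). -/
def yContent (m n : ℕ) : Fin n → ℤ := fun l => if (l : ℕ) < m then 1 else 0

/-- The content `Σ_{i ∈ I} ε(i)` of a maximal quantum minor `[I]`. -/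
def contentOf {n : ℕ} (I : Finset (Fin n)) : Fin n → ℤ := fun l => if l ∈ I then 1 else 0

/-- A realization of the twist `T(A)` of a `ℤ^n`-graded `K`-algebra `A` by a
2-cocycle `c`: a `K`-algebra `T` together with a `K`-linear isomorphism `τ : A ≃ T`
(the twist map `a ↦ a'`) satisfying `a'b' = c(s,t)·(ab)'` on homogeneous elements. -/
structure CocycleTwist {n : ℕ} (A : Type*) [Ring A] [Algebra K A]
    (𝒜 : (Fin n → ℤ) → Submodule K A) (c : (Fin n → ℤ) → (Fin n → ℤ) → K)
    (T : Type*) [Ring T] [Algebra K T] where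
  τ : A ≃ₗ[K] T
  mul_tw : ∀ (s t : Fin n → ℤ) (a b : A), a ∈ 𝒜 s → b ∈ 𝒜 t →
    τ a * τ b = c s t • τ (a * b)

/-- The image of an index set under the cycle `(1 2 … n)` (0-based). -/
def shiftSet {n : ℕ} (hn : 0 < n) (I : Finset (Fin n)) : Finset (Fin n) :=
  I.image fun a : Fin n => fmod n hn (a.val + 1)

end QG
namespace QG

/-- A matrix of elements of an algebra satisfying the quantum matrix relations. -/
structure IsQM {K : Type*} [Field K] (q : K) {A : Type*} [Ring A] [Algebra K A]
    {ι κ : Type*} [LinearOrder ι] [LinearOrder κ] (x : ι → κ → A) : Prop where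
  row : ∀ i j l, j < l → x i j * x i l = q • (x i l * x i j)
  col : ∀ i k j, i < k → x i j * x k j = q • (x k j * x i j)
  comm : ∀ i k j l, k < i → j < l → x i j * x k l = x k l * x i j
  qrel : ∀ i k j l, i < k → j < l →
    x i j * x k l - x k l * x i j = (q - q⁻¹) • (x i l * x k j)

section aux

variable {K : Type*} [Field K] {q : K} {A : Type*} [Ring A] [Algebra K A]
  {ι κ ι' κ' : Type*} [LinearOrder ι] [LinearOrder κ] [LinearOrder ι'] [LinearOrder κ']

theorem IsQM.transpose {x : ι → κ → A} (h : IsQM q x) : IsQM q (fun j i => x i j) where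
  row := fun i j l hjl => h.col j l i hjl
  col := fun i k j hik => h.row j i k hik
  comm := fun i k j l hki hjl => (h.comm l j k i hjl hki).symm
  qrel := fun i k j l hik hjl => by
    rw [h.qrel j l i k hjl hik, h.comm l j i k hjl hik]

theorem IsQM.sub {x : ι → κ → A} (h : IsQM q x) {f : ι' → ι} {g : κ' → κ}
    (hf : StrictMono f) (hg : StrictMono g) : IsQM q (fun i j => x (f i) (g j)) where
  row := fun _ _ _ hjl => h.row _ _ _ (hg hjl)
  col := fun _ _ _ hik => h.col _ _ _ (hf hik)
  comm := fun _ _ _ _ hki hjl => h.comm _ _ _ _ (hf hki) (hg hjl)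
  qrel := fun _ _ _ _ hik hjl => h.qrel _ _ _ _ (hf hik) (hg hjl)

theorem X_isQM (q : K) (m n : ℕ) : IsQM q (fun (i : Fin m) (j : Fin n) => X K q i j) where
  row := fun i j l h => by
    simpa [X] using RingQuot.mkAlgHom_rel K (QMatRel.row (q := q) i j l h)
  col := fun i k j h => by
    simpa [X] using RingQuot.mkAlgHom_rel K (QMatRel.col (q := q) i k j h)
  comm := fun i k j l h h' => by
    simpa [X] using RingQuot.mkAlgHom_rel K (QMatRel.comm (q := q) i k j l h h')
  qrel := fun i k j l h h' => by
    simpa only [X, map_sub, map_mul, map_smul] using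
      RingQuot.mkAlgHom_rel K (QMatRel.qrel (q := q) i k j l h h')

/-! ### inversions -/

theorem invCount_swap {t : ℕ} (σ : Equiv.Perm (Fin t)) (k k' : Fin t)
    (hk : (k' : ℕ) = k + 1) (h : σ k < σ k') :
    invCount (σ * Equiv.swap k k') = invCount σ + 1 := by
  classical
  unfold invCount
  have hkk : k ≠ k' := by intro e; rw [e] at hk; omega
  rw [← Finset.card_insert_of_notMem (a := (k', k))
    (s := (Finset.univ : Finset (Fin t × Fin t)).filter fun p => p.1 < p.2 ∧ σ p.2 < σ p.1)]
  · refine Finset.card_equiv ((Equiv.swap k k').prodCongr (Equiv.swap k k')) ?_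
    rintro ⟨a, b⟩
    simp only [Finset.mem_filter, Finset.mem_univ, true_and,
      Equiv.prodCongr_apply, Prod.map, Finset.mem_insert, Prod.mk.injEq]
    simp only [Equiv.Perm.mul_apply]
    by_cases ha : a = k
    · subst ha
      by_cases hb : b = k'
      · subst hb
        simp [h]
        rw [Fin.lt_def]; omega
      · by_cases hb' : b = a
        · subst hb'; simp [hkk.symm]
        · rw [Equiv.swap_apply_left, Equiv.swap_apply_of_ne_of_ne hb' hb]
          simp only [hb', and_false, false_or]
          have : a < b ↔ k' < b := by
            rw [Fin.lt_def, Fin.lt_def]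
            rw [Fin.ext_iff] at hb hb'; omega
          rw [this]
    · by_cases ha' : a = k'
      · subst ha'
        rw [Equiv.swap_apply_right]
        by_cases hb : b = k
        · subst hb
          rw [Equiv.swap_apply_left]
          simp [hkk, h.not_gt]
        · by_cases hb' : b = a
          · subst hb'; simp [hkk]
          · rw [Equiv.swap_apply_of_ne_of_ne hb hb']
            have : a < b ↔ k < b := by
              rw [Fin.lt_def, Fin.lt_def]
              rw [Fin.ext_iff] at hb hb'; omega
            rw [this]; simp [hkk]
      · rw [Equiv.swap_apply_of_ne_of_ne ha ha']
        simp only [ha', false_and, false_or]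
        rw [Fin.ext_iff] at ha ha'
        by_cases hb : b = k
        · subst hb
          rw [Equiv.swap_apply_left]
          have : a < b ↔ a < k' := by
            rw [Fin.lt_def, Fin.lt_def]; omega
          rw [this]
        · by_cases hb' : b = k'
          · subst hb'
            rw [Equiv.swap_apply_right]
            have : a < b ↔ a < k := by
              rw [Fin.lt_def, Fin.lt_def]; omega
            rw [this]
          · rw [Equiv.swap_apply_of_ne_of_ne hb hb']
  · simp only [Finset.mem_filter, Finset.mem_univ, true_and, not_and]
    intro h1
    rw [Fin.lt_def] at h1; omega

theorem invCount_inv {t : ℕ} (σ : Equiv.Perm (Fin t)) : invCount σ⁻¹ = invCount σ := by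
  unfold invCount
  refine Finset.card_equiv ((σ⁻¹.prodCongr σ⁻¹).trans (Equiv.prodComm _ _)) ?_
  rintro ⟨a, b⟩
  simp [and_comm]

/-! ### adjacent swaps -/

theorem prod_factor {t k : ℕ} (hk : k + 1 < t) :
    ∃ (F G : (Fin t → A) → A), (∀ g, (List.ofFn g).prod =
      F g * (g ⟨k, by omega⟩ * g ⟨k + 1, hk⟩) * G g) ∧
      ∀ g g' : Fin t → A, (∀ l : Fin t, (l : ℕ) ≠ k → (l : ℕ) ≠ k + 1 → g l = g' l) →
        F g = F g' ∧ G g = G g' := by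
  refine ⟨fun g => ((List.ofFn g).take k).prod, fun g => ((List.ofFn g).drop (k + 2)).prod,
    ?_, ?_⟩
  · intro g
    conv_lhs => rw [← List.take_append_drop k (List.ofFn g)]
    rw [List.prod_append, List.drop_eq_getElem_cons (by simp; omega),
      List.drop_eq_getElem_cons (by simp; omega)]
    simp [mul_assoc]
  · intro g g' h
    constructor
    · dsimp only
      congr 1
      apply List.ext_getElem
      · simp
      · intro i h1 h2
        simp at h1 h2 ⊢
        exact h _ (by simp; omega) (by simp; omega)
    · dsimp only
      congr 1
      apply List.ext_getElem
      · simp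
      · intro i h1 h2
        simp at h1 h2 ⊢
        exact h _ (by simp; omega) (by simp; omega)

theorem sum_pair {t : ℕ} (k k' : Fin t) (hkk : k ≠ k') (G : Equiv.Perm (Fin t) → A) :
    ∑ σ, G σ = ∑ σ ∈ Finset.univ.filter (fun σ : Equiv.Perm (Fin t) => σ k < σ k'),
      (G σ + G (σ * Equiv.swap k k')) := by
  rw [Finset.sum_add_distrib,
    ← Finset.sum_filter_add_sum_filter_not Finset.univ (fun σ => σ k < σ k')]
  congr 1
  symm
  refine Finset.sum_equiv (Equiv.mulRight (Equiv.swap k k')) ?_ ?_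
  · intro σ
    have : σ k ≠ σ k' := fun e => hkk (σ.injective e)
    simp [this.le_iff_lt]
  · intro σ _
    rfl

theorem qMinor_pair {t : ℕ} (q : K) (y : Fin t → Fin t → A) (k k' : Fin t)
    (hk : (k' : ℕ) = k + 1) :
    ∃ F G : Equiv.Perm (Fin t) → A, ∀ z : Fin t → Fin t → A,
      (∀ i l, l ≠ k → l ≠ k' → z i l = y i l) →
      qMinor K q t z = ∑ σ ∈ Finset.univ.filter (fun σ : Equiv.Perm (Fin t) => σ k < σ k'),
        F σ * (z (σ k) k * z (σ k') k' - q • (z (σ k') k * z (σ k) k')) * G σ := by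
  have hkk : k ≠ k' := by intro e; rw [e] at hk; omega
  obtain ⟨F, G, h1, h2⟩ := prod_factor (A := A) (t := t) (k := k) (by omega)
  have ek : (⟨k + 1, by omega⟩ : Fin t) = k' := Fin.ext hk.symm
  refine ⟨fun σ => (-q) ^ invCount σ • F (fun l => y (σ l) l), fun σ => G (fun l => y (σ l) l), ?_⟩
  intro z hz
  unfold qMinor
  rw [sum_pair k k' hkk]
  refine Finset.sum_congr rfl ?_
  intro σ hσ
  have hσ' : σ k < σ k' := by simpa using hσ
  rw [invCount_swap σ k k' hk hσ', h1, h1]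
  obtain ⟨e1, e2⟩ := h2 (fun l => z (σ l) l) (fun l => y (σ l) l) (by
    intro l ha hb
    exact hz _ _ (fun e => ha (by rw [e])) (fun e => hb (by rw [e, hk])))
  obtain ⟨e3, e4⟩ := h2 (fun l => z ((σ * Equiv.swap k k') l) l) (fun l => y (σ l) l) (by
    intro l ha hb
    have h3 : l ≠ k := fun e => ha (by rw [e])
    have h4 : l ≠ k' := fun e => hb (by rw [e, hk])
    rw [Equiv.Perm.mul_apply, Equiv.swap_apply_of_ne_of_ne h3 h4]
    exact hz _ _ h3 h4)
  rw [e1, e2, e3, e4]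
  simp only [ek, Fin.eta, Equiv.Perm.mul_apply, Equiv.swap_apply_left, Equiv.swap_apply_right]
  simp only [smul_mul_assoc, mul_sub, sub_mul, mul_smul_comm, smul_sub, pow_succ, mul_smul,
    neg_smul, smul_neg]
  module

theorem qMinor_adj_eq {t : ℕ} {x : Fin t → κ → A} (hx : IsQM q x) (c : Fin t → κ)
    (k k' : Fin t) (hk : (k' : ℕ) = k + 1) (hc : c k = c k') :
    qMinor K q t (fun i l => x i (c l)) = 0 := by
  obtain ⟨F, G, h⟩ := qMinor_pair q (fun i l => x i (c l)) k k' hk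
  rw [h _ (fun _ _ _ _ => rfl)]
  refine Finset.sum_eq_zero fun σ hσ => ?_
  have hσ' : σ k < σ k' := by simpa using hσ
  rw [hc, hx.col _ _ _ hσ', sub_self, mul_zero, zero_mul]

theorem qMinor_adj_swap (hq : q ≠ 0) {t : ℕ} {x : Fin t → κ → A} (hx : IsQM q x) (c : Fin t → κ)
    (k k' : Fin t) (hk : (k' : ℕ) = k + 1) (hc : c k < c k') :
    qMinor K q t (fun i l => x i (c (Equiv.swap k k' l))) =
      (-q) • qMinor K q t (fun i l => x i (c l)) := by
  obtain ⟨F, G, h⟩ := qMinor_pair q (fun i l => x i (c l)) k k' hk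
  rw [h _ (fun _ _ _ _ => rfl), h, Finset.smul_sum]
  · refine Finset.sum_congr rfl fun σ hσ => ?_
    have hσ' : σ k < σ k' := by simpa using hσ
    have h1 := hx.qrel _ _ _ _ hσ' hc
    have h2 := hx.comm _ _ _ _ hσ' hc
    have key : x (σ k) (c k') * x (σ k') (c k) - q • (x (σ k') (c k') * x (σ k) (c k)) =
        (-q) • (x (σ k) (c k) * x (σ k') (c k') - q • (x (σ k') (c k) * x (σ k) (c k'))) := by
      rw [h2, sub_eq_iff_eq_add.mp h1]
      have e : q * q⁻¹ = 1 := mul_inv_cancel₀ hq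
      simp only [smul_sub, smul_add, smul_smul, neg_mul, neg_smul, e, sub_smul, one_smul]
      abel
    rw [Equiv.swap_apply_left, Equiv.swap_apply_right, key, mul_smul_comm, smul_mul_assoc]
  · intro i l h1 h2
    rw [Equiv.swap_apply_of_ne_of_ne h1 h2]

theorem qMinor_repeat (hq : q ≠ 0) {t : ℕ} {x : Fin t → κ → A} (hx : IsQM q x) (d : ℕ) :
    ∀ (c : Fin t → κ) (k l : Fin t), (l : ℕ) = k + 1 + d → c k = c l →
    qMinor K q t (fun i l => x i (c l)) = 0 := by
  induction d with
  | zero => intro c k l h hc; exact qMinor_adj_eq hx c k l h hc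
  | succ d ih =>
    intro c k l h hc
    let k' : Fin t := ⟨k + 1, by omega⟩
    have hk : (k' : ℕ) = k + 1 := rfl
    have hlk : l ≠ k := by intro e; rw [e] at h; omega
    have hlk' : l ≠ k' := by intro e; rw [e] at h; omega
    have key := ih (fun l => c (Equiv.swap k k' l)) k' l (by omega) (by
      rw [Equiv.swap_apply_right, Equiv.swap_apply_of_ne_of_ne hlk hlk', hc])
    rcases lt_trichotomy (c k) (c k') with h1 | h1 | h1
    · have := qMinor_adj_swap hq hx c k k' hk h1
      rw [key] at this
      exact (smul_eq_zero.mp this.symm).resolve_left (neg_ne_zero.mpr hq)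
    · exact qMinor_adj_eq hx c k k' hk h1
    · have := qMinor_adj_swap hq hx (fun l => c (Equiv.swap k k' l)) k k' hk (by
        simpa using h1)
      rw [key, smul_zero] at this
      simpa using this

theorem qMinor_repeat' (hq : q ≠ 0) {t : ℕ} {x : Fin t → κ → A} (hx : IsQM q x)
    (c : Fin t → κ) (k l : Fin t) (h : k ≠ l) (hc : c k = c l) :
    qMinor K q t (fun i l => x i (c l)) = 0 := by
  have h' : (k : ℕ) ≠ l := fun e => h (Fin.ext e)
  rcases Nat.lt_or_gt_of_ne h' with h1 | h1
  · exact qMinor_repeat hq hx (l - k - 1) c k l (by omega) hc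
  · exact qMinor_repeat hq hx (k - l - 1) c l k (by omega) hc.symm

/-! ### moving a column to the last position -/

/-- Remove `p` from its place and reinsert it at position `k ≥ p`. -/
def mv {t : ℕ} (p : Fin t) (k : Fin t) (i : Fin t) : Fin t :=
  if i < p then i else if h : i < k then ⟨i + 1, by have := k.2; rw [Fin.lt_def] at h; omega⟩
  else if i = k then p else i

theorem mv_val {t : ℕ} (p k i : Fin t) : (mv p k i : ℕ) =
    if (i : ℕ) < p then (i : ℕ) else if (i : ℕ) < k then (i : ℕ) + 1
    else if (i : ℕ) = k then (p : ℕ) else (i : ℕ) := by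
  unfold mv
  simp only [Fin.lt_def, Fin.ext_iff]
  split_ifs <;> rfl

theorem succAbove_val' {t : ℕ} (a : Fin (t + 1)) (k : Fin t) : (a.succAbove k : ℕ) =
    if (k : ℕ) < a then (k : ℕ) else (k : ℕ) + 1 := by
  unfold Fin.succAbove
  simp only [Fin.lt_def, Fin.val_castSucc]
  split_ifs <;> rfl

theorem qMinor_mv (hq : q ≠ 0) {t : ℕ} {x : Fin t → κ → A} (hx : IsQM q x) {c : Fin t → κ}
    (hc : StrictMono c) (p : Fin t) (d : ℕ) : ∀ k : Fin t, (k : ℕ) = p + d →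
    qMinor K q t (fun i l => x i (c (mv p k l))) =
      (-q) ^ d • qMinor K q t (fun i l => x i (c l)) := by
  induction d with
  | zero =>
    intro k hk
    have : k = p := Fin.ext hk
    subst this
    have : ∀ l, mv k k l = l := by
      intro l; unfold mv; split_ifs <;> simp_all
    simp [this]
  | succ d ih =>
    intro k hk
    have hkt := k.2
    let k₀ : Fin t := ⟨p + d, by omega⟩
    have hk₀ : (k₀ : ℕ) = p + d := rfl
    have h1 := ih k₀ rfl
    have h2 := qMinor_adj_swap hq hx (fun l => c (mv p k₀ l)) k₀ k (by omega) (by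
      apply hc
      rw [Fin.lt_def, mv_val, mv_val]
      split_ifs <;> omega)
    have h3 : ∀ l, mv p k₀ (Equiv.swap k₀ k l) = mv p k l := by
      intro l
      rw [Equiv.swap_apply_def]
      apply Fin.ext
      simp only [mv_val, apply_ite Fin.val, Fin.ext_iff]
      split_ifs <;> omega
    simp only [h3] at h2
    rw [h2, h1, smul_smul, pow_succ']

/-! ### transpose -/

theorem prod_orderedInsert {α : Type*} (r : α → α → Prop) [DecidableRel r] (f : α → A) (p : α) :
    ∀ l : List α, (∀ b ∈ l, ¬ r p b → f p * f b = f b * f p) →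
    ((l.orderedInsert r p).map f).prod = f p * (l.map f).prod
  | [], _ => by simp
  | b :: l, h => by
    rw [List.orderedInsert]
    split_ifs with hr
    · simp
    · rw [List.map_cons, List.prod_cons, prod_orderedInsert r f p l
        (fun c hc => h c (List.mem_cons_of_mem _ hc)), List.map_cons, List.prod_cons,
        ← mul_assoc, ← mul_assoc, h b List.mem_cons_self hr]

theorem prod_insertionSort {α : Type*} (r : α → α → Prop) [DecidableRel r] (f : α → A) :
    ∀ l : List α, l.Pairwise (fun p b => ¬ r p b → f p * f b = f b * f p) →
    ((l.insertionSort r).map f).prod = (l.map f).prod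
  | [], _ => by simp
  | b :: l, h => by
    rw [List.pairwise_cons] at h
    rw [List.insertionSort_cons, prod_orderedInsert, prod_insertionSort r f l h.2, List.map_cons,
      List.prod_cons]
    intro c hc
    exact h.1 c ((List.perm_insertionSort r l).mem_iff.mp hc)

theorem prod_transpose {t : ℕ} {y : Fin t → Fin t → A} (hy : IsQM q y)
    (σ : Equiv.Perm (Fin t)) :
    (List.ofFn fun k => y (σ k) k).prod = (List.ofFn fun k => y k (σ⁻¹ k)).prod := by
  have h1 := prod_insertionSort (fun a b : Fin t => σ a ≤ σ b) (fun k => y (σ k) k)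
    (List.ofFn id) (by
      rw [List.pairwise_ofFn]
      intro i j hij h
      exact hy.comm _ _ _ _ (not_le.mp h) hij)
  rw [List.map_ofFn] at h1
  have h2 : (List.ofFn (id : Fin t → Fin t)).insertionSort (fun a b : Fin t => σ a ≤ σ b) =
      List.ofFn (fun k => σ⁻¹ k) := by
    have : Std.Total (fun a b : Fin t => σ a ≤ σ b) := ⟨fun a b => le_total _ _⟩
    have : IsTrans _ (fun a b : Fin t => σ a ≤ σ b) := ⟨fun a b c => le_trans⟩
    refine List.Perm.eq_of_pairwise (le := fun a b : Fin t => σ a ≤ σ b) ?_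
      (List.pairwise_insertionSort _ _) ?_ ?_
    · intro a b _ _ h h'
      exact σ.injective (le_antisymm h h')
    · rw [List.pairwise_ofFn]
      intro i j hij
      simpa using hij.le
    · refine (List.perm_insertionSort _ _).trans ?_
      exact (Equiv.Perm.ofFn_comp_perm σ⁻¹ id).symm
  rw [h2, List.map_ofFn] at h1
  rw [show (fun k => y (σ k) k) = (fun k => y (σ k) k) ∘ id from rfl, ← h1]
  congr 2
  funext k
  simp

theorem qMinor_transpose {t : ℕ} {y : Fin t → Fin t → A} (hy : IsQM q y) :
    qMinor K q t (fun i k => y k i) = qMinor K q t y := by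
  unfold qMinor
  rw [← Equiv.sum_comp (Equiv.inv (Equiv.Perm (Fin t)))]
  refine Finset.sum_congr rfl fun σ _ => ?_
  rw [Equiv.inv_apply, invCount_inv, prod_transpose hy]

/-! ### expansion along the first position -/

/-- The permutation sending `0` to `j` and `k+1` to `j.succAbove (σ k)`. -/
noncomputable def consPerm {t : ℕ} (j : Fin (t + 1)) (σ : Equiv.Perm (Fin t)) :
    Equiv.Perm (Fin (t + 1)) :=
  Equiv.ofBijective (Fin.cons j (fun k => j.succAbove (σ k))) (by
    apply Finite.injective_iff_bijective.mp
    rw [Fin.cons_injective_iff]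
    refine ⟨?_, fun a b h => σ.injective (Fin.succAbove_right_injective h)⟩
    rintro ⟨k, hk⟩
    exact Fin.succAbove_ne _ _ hk)

theorem consPerm_zero {t : ℕ} (j : Fin (t + 1)) (σ : Equiv.Perm (Fin t)) :
    consPerm j σ 0 = j := rfl

theorem consPerm_succ {t : ℕ} (j : Fin (t + 1)) (σ : Equiv.Perm (Fin t)) (k : Fin t) :
    consPerm j σ k.succ = j.succAbove (σ k) := rfl

theorem consPerm_bijective (t : ℕ) : Function.Bijective
    (fun p : Fin (t + 1) × Equiv.Perm (Fin t) => consPerm p.1 p.2) := by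
  rw [Fintype.bijective_iff_injective_and_card]
  constructor
  · rintro ⟨j, σ⟩ ⟨j', σ'⟩ h
    dsimp only at h
    have h0 : j = j' := by rw [← consPerm_zero j σ, h, consPerm_zero]
    subst h0
    have : σ = σ' := by
      ext1 k
      have := consPerm_succ j σ k
      rw [h, consPerm_succ] at this
      exact (Fin.succAbove_right_injective this).symm
    rw [this]
  · simp [Fintype.card_perm, Nat.factorial_succ]

theorem invCount_eq_sum {t : ℕ} (σ : Equiv.Perm (Fin t)) :
    invCount σ = ∑ a, ∑ b, if a < b ∧ σ b < σ a then 1 else 0 := by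
  unfold invCount
  rw [Finset.card_filter, ← Finset.univ_product_univ, Finset.sum_product]

theorem invCount_consPerm {t : ℕ} (j : Fin (t + 1)) (σ : Equiv.Perm (Fin t)) :
    invCount (consPerm j σ) = j + invCount σ := by
  rw [invCount_eq_sum, invCount_eq_sum, Fin.sum_univ_succ]
  congr 1
  · rw [Fin.sum_univ_succ]
    simp only [consPerm_zero, consPerm_succ, lt_irrefl, false_and, if_false, zero_add,
      Fin.succ_pos, true_and]
    rw [Equiv.sum_comp σ (fun k => if j.succAbove k < j then 1 else 0), ← Finset.card_filter]
    simp only [Fin.succAbove_lt_iff_castSucc_lt]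
    have : (Finset.univ.filter fun k : Fin t => k.castSucc < j).card = j := by
      have := Fin.card_filter_val_lt (n := t) (m := j)
      simp only [Fin.lt_def, Fin.val_castSucc]
      rw [this]; omega
    exact this
  · refine Finset.sum_congr rfl fun a _ => ?_
    rw [Fin.sum_univ_succ]
    simp [consPerm_succ, (Fin.strictMono_succAbove j).lt_iff_lt]

theorem qMinor_expand {t : ℕ} (y : Fin (t + 1) → Fin (t + 1) → A) :
    qMinor K q (t + 1) y = ∑ j : Fin (t + 1), (-q) ^ (j : ℕ) •
      (y j 0 * qMinor K q t (fun i k => y (j.succAbove i) k.succ)) := by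
  unfold qMinor
  rw [← (consPerm_bijective t).sum_comp, Fintype.sum_prod_type]
  refine Finset.sum_congr rfl fun j _ => ?_
  rw [Finset.mul_sum, Finset.smul_sum]
  refine Finset.sum_congr rfl fun σ _ => ?_
  dsimp only
  rw [invCount_consPerm, List.ofFn_succ, List.prod_cons, mul_smul_comm, smul_smul, pow_add,
    consPerm_zero]
  simp only [consPerm_succ]

/-- Quantum Cramer relation. -/
theorem cramer (hq : q ≠ 0) {m : ℕ} {x : Fin m → Fin (m + 1) → A} (hx : IsQM q x) (i : Fin m) :
    ∑ j : Fin (m + 1), (-q) ^ (j : ℕ) •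
      (x i j * qMinor K q m (fun a k => x a (j.succAbove k))) = 0 := by
  have h := qMinor_repeat' hq hx.transpose (Fin.cons i id : Fin (m + 1) → Fin m) 0 i.succ
    (Fin.succ_ne_zero i).symm (by simp)
  rw [qMinor_expand] at h
  rw [← h]
  refine Finset.sum_congr rfl fun j _ => ?_
  congr 2
  have := qMinor_transpose (hx.sub (f := id) (g := j.succAbove) strictMono_id
    (Fin.strictMono_succAbove j))
  simpa using this.symm

theorem cramer_minor (hq : q ≠ 0) {m : ℕ} {x : Fin (m + 1) → Fin (m + 2) → A} (hx : IsQM q x)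
    (c : Fin (m + 1) → Fin (m + 2)) :
    ∑ j : Fin (m + 2), (-q) ^ (j : ℕ) •
      (qMinor K q (m + 1) (fun a k => x a (if k = Fin.last m then j else c k)) *
        qMinor K q (m + 1) (fun a k => x a (j.succAbove k))) = 0 := by
  have h : ∀ j, qMinor K q (m + 1) (fun a k => x a (if k = Fin.last m then j else c k)) =
      ∑ σ : Equiv.Perm (Fin (m + 1)), ((-q) ^ invCount σ •
        (List.ofFn fun k : Fin m => x (σ k.castSucc) (c k.castSucc)).prod) *
          x (σ (Fin.last m)) j := by
    intro j
    unfold qMinor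
    refine Finset.sum_congr rfl fun σ _ => ?_
    rw [List.ofFn_succ_last, List.prod_append]
    simp [Fin.castSucc_ne_last]
  simp only [h, Finset.sum_mul, Finset.smul_sum]
  rw [Finset.sum_comm]
  refine Finset.sum_eq_zero fun σ _ => ?_
  have := congrArg (fun z => ((-q) ^ invCount σ •
    (List.ofFn fun k : Fin m => x (σ k.castSucc) (c k.castSucc)).prod) * z)
    (cramer hq hx (σ (Fin.last m)))
  rw [mul_zero, Finset.mul_sum] at this
  rw [← this]
  refine Finset.sum_congr rfl fun j _ => ?_
  rw [mul_smul_comm, mul_assoc]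

theorem minor_comm (hq : q ≠ 0) {m : ℕ} {x : Fin (m + 1) → Fin (m + 2) → A} (hx : IsQM q x)
    (a b : Fin (m + 2)) (hab : a < b) :
    qMinor K q (m + 1) (fun i k => x i (b.succAbove k)) *
        qMinor K q (m + 1) (fun i k => x i (a.succAbove k)) =
      q • (qMinor K q (m + 1) (fun i k => x i (a.succAbove k)) *
        qMinor K q (m + 1) (fun i k => x i (b.succAbove k))) := by
  rw [Fin.lt_def] at hab
  have hb := b.2
  -- positions of `b` in the complement of `a` and of `a` in the complement of `b`
  let pb : Fin (m + 1) := ⟨b - 1, by omega⟩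
  let pa : Fin (m + 1) := ⟨a, by omega⟩
  have h := cramer_minor hq hx (fun k => a.succAbove (mv pb (Fin.last m) k))
  have eb : ∀ k, (if k = Fin.last m then b else a.succAbove (mv pb (Fin.last m) k)) =
      a.succAbove (mv pb (Fin.last m) k) := by
    intro k
    have hk := k.2
    apply Fin.ext
    simp only [apply_ite Fin.val, mv_val, succAbove_val', Fin.ext_iff, Fin.val_last, pb]
    split_ifs <;> omega
  have ea : ∀ k, (if k = Fin.last m then a else a.succAbove (mv pb (Fin.last m) k)) =
      b.succAbove (mv pa (Fin.last m) k) := by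
    intro k
    have hk := k.2
    apply Fin.ext
    simp only [apply_ite Fin.val, mv_val, succAbove_val', Fin.ext_iff, Fin.val_last, pb, pa]
    split_ifs <;> omega
  rw [← Finset.sum_subset (Finset.subset_univ {a, b}), Finset.sum_pair
    (by intro e; rw [e] at hab; omega)] at h
  · simp only [eb, ea] at h
    rw [qMinor_mv hq hx (Fin.strictMono_succAbove b) pa (m - a) _ (by simp [pa]; omega),
      qMinor_mv hq hx (Fin.strictMono_succAbove a) pb (m + 1 - b) _ (by simp [pb]; omega),
      smul_mul_assoc, smul_mul_assoc, smul_smul, smul_smul, ← pow_add, ← pow_add,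
      show (a : ℕ) + (m - a) = m by omega, show (b : ℕ) + (m + 1 - b) = m + 1 by omega,
      pow_succ, mul_smul, ← smul_add] at h
    have := (smul_eq_zero.mp h).resolve_left (pow_ne_zero _ (neg_ne_zero.mpr hq))
    rw [neg_smul, ← sub_eq_add_neg, sub_eq_zero] at this
    exact this
  · intro j _ hj
    simp only [Finset.mem_insert, Finset.mem_singleton, not_or, Fin.ext_iff] at hj
    have hj2 := j.2
    -- the position of `j` in the sequence
    let l : ℕ := if (j : ℕ) < a then j else if (j : ℕ) < b then j - 1 else j - 2
    have hl : l < m := by simp only [l]; split_ifs <;> omega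
    rw [qMinor_repeat' hq hx _ (⟨l, by omega⟩ : Fin (m + 1)) (Fin.last m) (by
      rw [Ne, Fin.ext_iff]; simp; omega), zero_mul, smul_zero]
    rw [if_pos rfl, if_neg (by rw [Fin.ext_iff]; simp; omega)]
    apply Fin.ext
    simp only [mv_val, succAbove_val', Fin.val_last, pb, l]
    split_ifs <;> omega

/-! ### application to the quantum grassmannian -/

theorem grMinor_erase {m n : ℕ} (q : K) (U : Finset (Fin n)) (hU : U.card = m + 1)
    (a : Fin (m + 1)) :
    grMinor K q m (U.erase (U.orderEmbOfFin hU a)) =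
      qMinor K q m (fun i k => X K q i (U.orderEmbOfFin hU (a.succAbove k))) := by
  have hc : (U.erase (U.orderEmbOfFin hU a)).card = m := by
    rw [Finset.card_erase_of_mem (Finset.orderEmbOfFin_mem _ _ _), hU]; rfl
  unfold grMinor
  rw [dif_pos hc]
  have := Finset.orderEmbOfFin_unique hc (f := fun k => U.orderEmbOfFin hU (a.succAbove k))
    (by
      intro k
      rw [Finset.mem_erase]
      refine ⟨?_, Finset.orderEmbOfFin_mem _ _ _⟩
      intro e
      exact Fin.succAbove_ne _ _ ((U.orderEmbOfFin hU).injective e))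
    ((U.orderEmbOfFin hU).strictMono.comp (Fin.strictMono_succAbove a))
  congr 1
  funext i k
  rw [← this]

theorem grMinor_comm (hq : q ≠ 0) {m n : ℕ} (hm : 0 < m) (U : Finset (Fin n))
    (hU : U.card = m + 1) (a b : Fin n) (ha : a ∈ U) (hb : b ∈ U) (hab : a < b) :
    grMinor K q m (U.erase b) * grMinor K q m (U.erase a) =
      q • (grMinor K q m (U.erase a) * grMinor K q m (U.erase b)) := by
  obtain ⟨m, rfl⟩ : ∃ m', m = m' + 1 := ⟨m - 1, by omega⟩
  have hr := Finset.range_orderEmbOfFin U hU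
  obtain ⟨a, rfl⟩ : a ∈ Set.range (U.orderEmbOfFin hU) := by rw [hr]; exact ha
  obtain ⟨b, rfl⟩ : b ∈ Set.range (U.orderEmbOfFin hU) := by rw [hr]; exact hb
  rw [grMinor_erase, grMinor_erase]
  exact minor_comm hq ((X_isQM q (m + 1) n).sub (f := id) strictMono_id
    (U.orderEmbOfFin hU).strictMono) a b ((U.orderEmbOfFin hU).strictMono.lt_iff_lt.mp hab)

theorem mem_consecSet_one {m n : ℕ} (hn : 0 < n) (hmn : m < n) (a : Fin n) :
    a ∈ consecSet hn m 1 ↔ 1 ≤ (a : ℕ) ∧ (a : ℕ) ≤ m := by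
  unfold consecSet fmod
  simp only [Finset.mem_image, Finset.mem_range, Fin.ext_iff]
  constructor
  · rintro ⟨k, hk, h⟩
    rw [Nat.mod_eq_of_lt (by omega)] at h
    omega
  · rintro ⟨h1, h2⟩
    exact ⟨a - 1, by omega, by rw [Nat.mod_eq_of_lt (by omega)]; omega⟩

theorem card_consecSet_one {m n : ℕ} (hn : 0 < n) (hmn : m < n) :
    (consecSet hn m 1).card = m := by
  unfold consecSet fmod
  rw [Finset.card_image_of_injOn, Finset.card_range]
  intro a ha b hb h
  simp only [Finset.coe_range, Set.mem_Iio, Fin.mk.injEq] at ha hb h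
  rw [Nat.mod_eq_of_lt (by omega), Nat.mod_eq_of_lt (by omega)] at h
  omega

/-- The commutation relation, in the quantum grassmannian. -/
theorem grE_comm (hq : q ≠ 0) {m n : ℕ} (hn : 0 < n) (hm : 0 < m) (hmn : m < n)
    (i : Fin m) (j : Fin (n - m)) :
    ((j : ℕ) < n - m - 1 → grE K q m (consecSet hn m 1) * grE K q m (JxSet hn m 1 i j) =
      q • (grE K q m (JxSet hn m 1 i j) * grE K q m (consecSet hn m 1))) ∧
    ((j : ℕ) = n - m - 1 → grE K q m (consecSet hn m 1) * grE K q m (JxSet hn m 1 i j) =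
      q⁻¹ • (grE K q m (JxSet hn m 1 i j) * grE K q m (consecSet hn m 1))) := by
  have hj := j.2
  set M := consecSet hn m 1 with hM
  set b := fmod n hn (1 + m + j) with hbdef
  set a := fmod n hn (1 + (m - 1 - i)) with hadef
  have hav : (a : ℕ) = 1 + (m - 1 - i) := by
    simp only [hadef, fmod]; exact Nat.mod_eq_of_lt (by omega)
  have haM : a ∈ M := by rw [hM, mem_consecSet_one hn hmn]; omega
  have hbM : b ∉ M := by
    rw [hM, mem_consecSet_one hn hmn]
    simp only [hbdef, fmod]
    by_cases h : 1 + m + (j : ℕ) < n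
    · rw [Nat.mod_eq_of_lt h]; omega
    · rw [show 1 + m + (j : ℕ) = n by omega, Nat.mod_self]; omega
  have hne : b ≠ a := fun e => hbM (e ▸ haM)
  have hU : (insert b M).card = m + 1 := by
    rw [Finset.card_insert_of_notMem hbM, hM, card_consecSet_one hn hmn]
  have e1 : (insert b M).erase b = M := Finset.erase_insert hbM
  have e2 : (insert b M).erase a = JxSet hn m 1 i j := by
    rw [Finset.erase_insert_of_ne hne]; rfl
  have hbU : b ∈ insert b M := Finset.mem_insert_self _ _
  have haU : a ∈ insert b M := Finset.mem_insert_of_mem haM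
  constructor
  · intro h
    have := grMinor_comm (K := K) hq hm _ hU a b haU hbU (by
      rw [Fin.lt_def, hav]; simp only [hbdef, fmod]
      rw [Nat.mod_eq_of_lt (by omega)]; omega)
    rw [e1, e2] at this
    exact Subtype.ext this
  · intro h
    have := grMinor_comm (K := K) hq hm _ hU b a hbU haU (by
      rw [Fin.lt_def, hav]; simp only [hbdef, fmod]
      rw [show 1 + m + (j : ℕ) = n by omega, Nat.mod_self]; omega)
    rw [e1, e2] at this
    have h2 : grE K q m (JxSet hn m 1 i j) * grE K q m M =
      q • (grE K q m M * grE K q m (JxSet hn m 1 i j)) := Subtype.ext this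
    rw [h2, smul_smul, inv_mul_cancel₀ hq, one_smul]

end aux

theorem loc_aux {K B : Type*} [Field K] [Ring B] [Algebra K B] (u : Bˣ) (v w : B) (c : K)
    (hw : w = u) (h : w * v = c • (v * w)) :
    ((u : B) * (v * ↑u⁻¹) * ↑u⁻¹ = c • (v * ↑u⁻¹)) ∧
      w * (v * ↑u⁻¹) = c • (v * ↑u⁻¹ * w) := by
  subst hw
  constructor
  · rw [← mul_assoc, h]; simp [mul_assoc]
  · rw [← mul_assoc, h]; simp [mul_assoc]

/-- For the dehomogenisation at `α = 2` (0-based `α = 1`), the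
automorphism `σ₂` (conjugation by `M₂`) satisfies `σ₂(z_{ij}) = q·z_{ij}` for
`j < n−m` and `σ₂(z_{i,n−m}) = q⁻¹·z_{i,n−m}`;  consequently
`y₂ z_{ij} = q z_{ij} y₂` for `j < n−m` and `y₂ z_{i,n−m} = q⁻¹ z_{i,n−m} y₂`. -/
theorem sigma_two_action
    (K : Type*) [Field K] (q : K) (hq : q ≠ 0) (m n : ℕ) (hm : 0 < m) (hmn : m < n)
    (B : Type*) [Ring B] [Algebra K B]
    (L : NormalLoc K (↥(qGrass K q m n)) B
      (grE K q m (consecSet (show 0 < n by omega) m 1))) :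
    ∀ (i : Fin m) (j : Fin (n - m)),
      ((j : ℕ) < n - m - 1 →
        ((L.isUnit.unit : B) * xElt K q m n (show 0 < n by omega) 1 L i j *
            ((L.isUnit.unit⁻¹ : Bˣ) : B) =
          q • xElt K q m n (show 0 < n by omega) 1 L i j) ∧
        L.emb (grE K q m (consecSet (show 0 < n by omega) m 1)) *
            xElt K q m n (show 0 < n by omega) 1 L i j =
          q • (xElt K q m n (show 0 < n by omega) 1 L i j *
            L.emb (grE K q m (consecSet (show 0 < n by omega) m 1)))) ∧
      ((j : ℕ) = n - m - 1 →
        ((L.isUnit.unit : B) * xElt K q m n (show 0 < n by omega) 1 L i j *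
            ((L.isUnit.unit⁻¹ : Bˣ) : B) =
          q⁻¹ • xElt K q m n (show 0 < n by omega) 1 L i j) ∧
        L.emb (grE K q m (consecSet (show 0 < n by omega) m 1)) *
            xElt K q m n (show 0 < n by omega) 1 L i j =
          q⁻¹ • (xElt K q m n (show 0 < n by omega) 1 L i j *
            L.emb (grE K q m (consecSet (show 0 < n by omega) m 1)))) := by
  intro i j
  have h := grE_comm (K := K) hq (show 0 < n by omega) hm hmn i j
  constructor
  · intro hj
    refine loc_aux L.isUnit.unit _ _ q (IsUnit.unit_spec L.isUnit).symm ?_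
    rw [← map_mul, h.1 hj, map_smul, map_mul]
  · intro hj
    refine loc_aux L.isUnit.unit _ _ q⁻¹ (IsUnit.unit_spec L.isUnit).symm ?_
    rw [← map_mul, h.2 hj, map_smul, map_mul]

end QG
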